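/- Let c > 0 and K > 2/c + 19. Let x* ∈ Ē⁺ with Gp(x*) ≠ ∅, and let I₀ ∈ Gp(x*) be an element of minimal length, i.e. |I₀| = min{|I| : I ∈ Gp(x*)}. If J ∈ Gp(x*) satisfies |J| > c · dist(x*, I₀), then J is easy. -/

import Mathlib

/-- An axis-parallel square, recorded by its lower-left corner `(x, y)` and side length `s`. -/
structure Sq where
  x : ℝ
  y : ℝ
  s : ℝ

namespace Sq

/-- The (closed) square as a subset of ℝ². -/
def set (Q : Sq) : Set (ℝ × ℝ) :=
  Set.Icc Q.x (Q.x + Q.s) ×ˢ Set.Icc Q.y (Q.y + Q.s)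

/-- `Q.dilate C` is the *open* axis-parallel square `CQ` with the same center as `Q` and
side length `C·δ_Q`. -/
def dilate (Q : Sq) (C : ℝ) : Set (ℝ × ℝ) :=
  Set.Ioo (Q.x + Q.s / 2 - C * Q.s / 2) (Q.x + Q.s / 2 + C * Q.s / 2) ×ˢ
    Set.Ioo (Q.y + Q.s / 2 - C * Q.s / 2) (Q.y + Q.s / 2 + C * Q.s / 2)

/-- Dyadic squares: `Q⁰ = [-1,1]²` and all closed squares obtained from `Q⁰` by successive
bisection, i.e. `[i·2^{-k}, (i+1)·2^{-k}] × [j·2^{-k}, (j+1)·2^{-k}]` with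
`i, j ∈ {-2^k, …, 2^k - 1}`. -/
def IsDyadic (Q : Sq) : Prop :=
  (Q.x = -1 ∧ Q.y = -1 ∧ Q.s = 2) ∨
    ∃ (k : ℕ) (i j : ℤ), -(2 ^ k : ℤ) ≤ i ∧ i < 2 ^ k ∧ -(2 ^ k : ℤ) ≤ j ∧ j < 2 ^ k ∧
      Q.x = (i : ℝ) * (2 : ℝ) ^ (-(k : ℤ)) ∧ Q.y = (j : ℝ) * (2 : ℝ) ^ (-(k : ℤ)) ∧
      Q.s = (2 : ℝ) ^ (-(k : ℤ))

end Sq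

/-- A closed interval, recorded by its left endpoint `a` and length `len`. -/
structure Iv where
  a : ℝ
  len : ℝ

namespace Iv

/-- The (closed) interval as a subset of ℝ. -/
def set (I : Iv) : Set ℝ := Set.Icc I.a (I.a + I.len)

/-- `I.dil C` is the *open* interval `CI` with the same center as `I` and length `C·|I|`. -/
def dil (I : Iv) (C : ℝ) : Set ℝ :=
  Set.Ioo (I.a + I.len / 2 - C * I.len / 2) (I.a + I.len / 2 + C * I.len / 2)

/-- Dyadic intervals: `I⁰ = [-1,1]` and all closed intervals
`[i·2^{-k}, (i+1)·2^{-k}]` with `i ∈ {-2^k, …, 2^k - 1}`, obtained from `I⁰` by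
successive bisection. -/
def IsDyadic (I : Iv) : Prop :=
  (I.a = -1 ∧ I.len = 2) ∨
    ∃ (k : ℕ) (i : ℤ), -(2 ^ k : ℤ) ≤ i ∧ i < 2 ^ k ∧
      I.a = (i : ℝ) * (2 : ℝ) ^ (-(k : ℤ)) ∧ I.len = (2 : ℝ) ^ (-(k : ℤ))

end Iv

/-- `E = Ē × {0} ⊂ ℝ²`. -/
def Eset (Ebar : Finset ℝ) : Set (ℝ × ℝ) := {z | z.1 ∈ Ebar ∧ z.2 = 0}

/-- The hypotheses on the finite set `Ē ⊂ ℝ`: `#Ē ≥ 2` (so `N = #E ≥ 2`),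
`max Ē = 2^{-11}` and `min Ē = -2^{-11}`. -/
def EbarHyp (Ebar : Finset ℝ) : Prop :=
  2 ≤ Ebar.card ∧ (2 : ℝ) ^ (-(11 : ℤ)) ∈ Ebar ∧ -(2 : ℝ) ^ (-(11 : ℤ)) ∈ Ebar ∧
    ∀ x ∈ Ebar, -(2 : ℝ) ^ (-(11 : ℤ)) ≤ x ∧ x ≤ (2 : ℝ) ^ (-(11 : ℤ))

/-- The Calderón–Zygmund collection `CZ`: the maximal dyadic squares `Q` such that
`#(E ∩ 3Q) ≤ 1` (where `3Q` is the open concentric dilation). -/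
def CZ (Ebar : Finset ℝ) (Q : Sq) : Prop :=
  Q.IsDyadic ∧ (Eset Ebar ∩ Q.dilate 3).Subsingleton ∧
    ∀ Q' : Sq, Q'.IsDyadic → (Eset Ebar ∩ Q'.dilate 3).Subsingleton →
      Q.set ⊆ Q'.set → Q.set = Q'.set

/-- The shadow `π(Q)` of a square `Q`, where `π(x,y) = x`. -/
def shadow (Q : Sq) : Iv := ⟨Q.x, Q.s⟩

/-- `Ē⁺ = Ē ∪ {-1}`. -/
noncomputable def EbarPlus (Ebar : Finset ℝ) : Finset ℝ := insert (-1) Ebar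

/-- `I` is a shadow of some CZ square. -/
def IsShadow (Ebar : Finset ℝ) (I : Iv) : Prop :=
  ∃ Q : Sq, CZ Ebar Q ∧ shadow Q = I

/-- The group `Gp(x*)`: the set of shadows `I` of CZ squares such that
(a) `x* ≤ inf 41I` (note `inf 41I = I.a - 20·|I|`), and
(b) `Ē⁺ ∩ (x*, inf 9I] = ∅` (note `inf 9I = I.a - 4·|I|`). -/
def Gp (Ebar : Finset ℝ) (xstar : ℝ) (I : Iv) : Prop :=
  IsShadow Ebar I ∧ xstar ≤ I.a - 20 * I.len ∧
    ∀ x ∈ EbarPlus Ebar, ¬(xstar < x ∧ x ≤ I.a - 4 * I.len)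

/-- A shadow `I` is *easy* (for the parameter `K`) if `diam(Ē⁺ ∩ KI) ≥ K⁻¹·|I|`. -/
def EasyShadow (Ebar : Finset ℝ) (K : ℝ) (I : Iv) : Prop :=
  ∃ u ∈ EbarPlus Ebar, ∃ v ∈ EbarPlus Ebar,
    u ∈ I.dil K ∧ v ∈ I.dil K ∧ K⁻¹ * I.len ≤ |u - v|

/-- The square `Q_inner = [-2^{-10}, 2^{-10}]²`. -/
def Qinner : Set (ℝ × ℝ) :=
  Set.Icc (-(2 : ℝ) ^ (-(10 : ℤ))) ((2 : ℝ) ^ (-(10 : ℤ))) ×ˢ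
    Set.Icc (-(2 : ℝ) ^ (-(10 : ℤ))) ((2 : ℝ) ^ (-(10 : ℤ)))

/-- A CZ square is *relevant* if `1.1Q ∩ Q_inner ≠ ∅`. -/
def Relevant (Ebar : Finset ℝ) (Q : Sq) : Prop :=
  CZ Ebar Q ∧ (Q.dilate 1.1 ∩ Qinner).Nonempty

namespace Sq

lemma IsDyadic.s_pos {Q : Sq} (hQ : Q.IsDyadic) : 0 < Q.s := by
  rcases hQ with ⟨-, -, h⟩ | ⟨k, i, j, -, -, -, -, -, -, h⟩ <;> rw [h] <;> positivity

/-- Every dyadic square other than `[-1,1]²` has a dyadic parent of twice its side length. -/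
lemma IsDyadic.exists_parent {Q : Sq} (hQ : Q.IsDyadic)
    (hne : ¬(Q.x = -1 ∧ Q.y = -1 ∧ Q.s = 2)) :
    ∃ P : Sq, P.IsDyadic ∧ P.s = 2 * Q.s ∧
      (P.x ≤ Q.x ∧ Q.x ≤ P.x + Q.s) ∧ (P.y ≤ Q.y ∧ Q.y ≤ P.y + Q.s) := by
  obtain ⟨k, i, j, hi, hi', hj, hj', hx, hy, hs⟩ := hQ.resolve_left hne
  rcases k with _ | k
  · simp only [pow_zero, Nat.cast_zero, neg_zero, zpow_zero, mul_one] at *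
    have hi1 : (-1 : ℝ) ≤ i := by exact_mod_cast hi
    have hj1 : (-1 : ℝ) ≤ j := by exact_mod_cast hj
    have hi2 : (i : ℝ) ≤ 0 := by exact_mod_cast Int.lt_add_one_iff.mp hi'
    have hj2 : (j : ℝ) ≤ 0 := by exact_mod_cast Int.lt_add_one_iff.mp hj'
    refine ⟨⟨-1, -1, 2⟩, Or.inl ⟨rfl, rfl, rfl⟩, ?_, ?_, ?_⟩ <;> simp only [hx, hy, hs]
    · norm_num
    · constructor <;> linarith
    · constructor <;> linarith
  · have hpow : (2 : ℝ) ^ (-(k : ℤ)) = 2 * (2 : ℝ) ^ (-((k + 1 : ℕ) : ℤ)) := by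
      rw [← zpow_one_add₀ two_ne_zero]
      congr 1
      push_cast
      ring
    have hpos : (0 : ℝ) < (2 : ℝ) ^ (-((k + 1 : ℕ) : ℤ)) := by positivity
    have half (n : ℤ) : 2 * ((n / 2 : ℤ) : ℝ) ≤ n ∧ (n : ℝ) ≤ 2 * ((n / 2 : ℤ) : ℝ) + 1 := by
      constructor
      · exact_mod_cast (by lia : 2 * (n / 2) ≤ n)
      · exact_mod_cast (by lia : n ≤ 2 * (n / 2) + 1)
    rw [pow_succ] at hi hi' hj hj'
    refine ⟨⟨(i / 2 : ℤ) * (2 : ℝ) ^ (-(k : ℤ)), (j / 2 : ℤ) * (2 : ℝ) ^ (-(k : ℤ)),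
      (2 : ℝ) ^ (-(k : ℤ))⟩, Or.inr ⟨k, i / 2, j / 2, by lia, by lia, by lia, by lia,
      rfl, rfl, rfl⟩, ?_, ?_, ?_⟩
    · simp only [hs, hpow]
    · simp only [hx, hs, hpow]
      constructor <;> nlinarith [half i]
    · simp only [hy, hs, hpow]
      constructor <;> nlinarith [half j]

end Sq

/-- `Ē` meets `7I` for every shadow `I` of a Calderón–Zygmund square. -/
lemma IsShadow.exists_mem_dil_seven {Ebar : Finset ℝ} (hE : EbarHyp Ebar) {I : Iv}
    (hI : IsShadow Ebar I) : 0 < I.len ∧ ∃ y ∈ Ebar, y ∈ I.dil 7 := by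
  obtain ⟨Q, ⟨hdy, hsub, hmax⟩, rfl⟩ := hI
  have hs := hdy.s_pos
  refine ⟨hs, ?_⟩
  have hne : ¬(Q.x = -1 ∧ Q.y = -1 ∧ Q.s = 2) := by
    rintro ⟨hx, hy, hs2⟩
    obtain ⟨-, h₁, h₂, -⟩ := hE
    have h := hsub (x := ((2 : ℝ) ^ (-(11 : ℤ)), 0)) (y := (-(2 : ℝ) ^ (-(11 : ℤ)), 0))
      ⟨⟨h₁, rfl⟩, by simp only [Sq.dilate, hx, hy, hs2]; norm_num⟩
      ⟨⟨h₂, rfl⟩, by simp only [Sq.dilate, hx, hy, hs2]; norm_num⟩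
    norm_num at h
  obtain ⟨P, hP, hPs, ⟨hx, hx'⟩, hy, hy'⟩ := hdy.exists_parent hne
  have hQP : Q.set ⊆ P.set :=
    Set.prod_mono (Set.Icc_subset_Icc hx (by linarith)) (Set.Icc_subset_Icc hy (by linarith))
  have hnot : ¬(Eset Ebar ∩ P.dilate 3).Subsingleton := by
    intro h
    have heq := hmax P hP h hQP
    have hlo : (P.x, P.y) ∈ Q.set := by
      rw [heq]
      simp only [Sq.set, Set.mem_prod, Set.mem_Icc]
      refine ⟨⟨?_, ?_⟩, ?_, ?_⟩ <;> linarith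
    have hhi : (P.x + P.s, P.y + P.s) ∈ Q.set := by
      rw [heq]
      simp only [Sq.set, Set.mem_prod, Set.mem_Icc]
      refine ⟨⟨?_, ?_⟩, ?_, ?_⟩ <;> linarith
    have h₁ := hlo.1.1
    have h₂ := hhi.1.2
    simp only at h₁ h₂
    linarith
  obtain ⟨z, ⟨hzE, -⟩, ⟨hz₁, hz₂⟩, -⟩ := (Set.not_subsingleton_iff.mp hnot).nonempty
  refine ⟨z.1, hzE, ?_, ?_⟩ <;> simp only [shadow] <;> linarith

/-- let `c > 0` and `K > 2/c + 19`. Let `x* ∈ Ē⁺`, let `I₀ ∈ Gp(x*)` have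
minimal length in `Gp(x*)`, and let `J ∈ Gp(x*)` with `|J| > c·dist(x*, I₀)`. Then `J` is
easy. -/
theorem long_group_shadows_are_easy (c K : ℝ) (hc : 0 < c) (hK : 2 / c + 19 < K)
    (Ebar : Finset ℝ) (hE : EbarHyp Ebar)
    (xstar : ℝ) (hx : xstar ∈ EbarPlus Ebar)
    (I₀ : Iv) (hI₀ : Gp Ebar xstar I₀)
    (hmin : ∀ J : Iv, Gp Ebar xstar J → I₀.len ≤ J.len)
    (J : Iv) (hJ : Gp Ebar xstar J)
    (hlen : c * Metric.infDist xstar I₀.set < J.len) :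
    EasyShadow Ebar K J := by
  obtain ⟨hsh₀, hx₀, -⟩ := hI₀
  have hle : I₀.len ≤ J.len := hmin J hJ
  obtain ⟨hsh, hxJ, hgap⟩ := hJ
  obtain ⟨hpos₀, y₀, hy₀, hy₀l, hy₀r⟩ := hsh₀.exists_mem_dil_seven hE
  obtain ⟨hpos, y, hy, hyl, hyr⟩ := hsh.exists_mem_dil_seven hE
  have hK0 : 0 < 2 / c := by positivity
  have hdist : I₀.a - xstar < 1 / c * J.len := by
    rw [one_div, inv_mul_eq_div, lt_div_iff₀ hc]
    have : I₀.a - xstar ≤ Metric.infDist xstar I₀.set := by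
      have hne : I₀.set.Nonempty := ⟨I₀.a, le_rfl, by linarith⟩
      refine (Metric.le_infDist hne).mpr fun z hz => ?_
      rw [dist_comm, Real.dist_eq]
      exact (sub_le_sub_right hz.1 _).trans (le_abs_self _)
    nlinarith
  have hJ₀ : J.a - 4 * J.len < y₀ := by
    by_contra! h
    exact hgap y₀ (Finset.mem_insert_of_mem hy₀) ⟨by linarith, h⟩
  have hKlen : (2 / c + 19) * J.len < K * J.len := by gcongr
  have hc2 : 2 / c * J.len = 2 * (1 / c * J.len) := by ring
  have hcpos : 0 < 2 / c * J.len := by positivity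
  refine ⟨xstar, hx, y, Finset.mem_insert_of_mem hy, ⟨?_, ?_⟩, ⟨?_, ?_⟩, ?_⟩
  · linarith
  · linarith
  · linarith
  · linarith
  · have hKinv : K⁻¹ * J.len ≤ 1 * J.len := by
      gcongr
      exact inv_le_one_of_one_le₀ (by linarith)
    rw [abs_sub_comm]
    exact le_trans (by linarith) (le_abs_self _)
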